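/- Let q be a power of 3 (so q is odd) and F = F_q. The subspace W₁₄' = {[[a+c,c,c],[c,b+c,c],[c,c,−b]] : a,b,c ∈ F} of Sym₃(F) (a representative of the orbit Σ₁₄' arising only in characteristic 3) has point-orbit distribution [1, q, 0, q²]; in particular it contains exactly one rank-1 point, exactly q rank-2 points, all of which are exterior, and q² rank-3 points. -/

import Mathlib

open Matrix

/-- The number of points (1-dimensional subspaces) contained in a set `S` of `3 × 3`
matrices whose (nonzero) spanning matrices satisfy the property `P`. -/
noncomputable def ptsWith (F : Type*) [Field F] (S : Set (Matrix (Fin 3) (Fin 3) F))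
    (P : Matrix (Fin 3) (Fin 3) F → Prop) : ℕ :=
  Set.ncard {p : Submodule F (Matrix (Fin 3) (Fin 3) F) |
    ↑p ⊆ S ∧ Module.finrank F ↥p = 1 ∧ ∃ M ∈ p, M ≠ 0 ∧ P M}

/-- A matrix is exterior if it is congruent to `diag(1, −1, 0)`. -/
def Exterior {F : Type*} [Field F] (M : Matrix (Fin 3) (Fin 3) F) : Prop :=
  ∃ A : Matrix (Fin 3) (Fin 3) F, IsUnit A ∧ A * M * Aᵀ = diagonal ![1, -1, 0]

/-- A matrix is interior if it is congruent to `diag(1, −ε, 0)` for some nonsquare `ε`. -/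
def Interior {F : Type*} [Field F] (M : Matrix (Fin 3) (Fin 3) F) : Prop :=
  ∃ (A : Matrix (Fin 3) (Fin 3) F) (ε : F), IsUnit A ∧ ¬ IsSquare ε ∧
    A * M * Aᵀ = diagonal ![1, -ε, 0]

/-- `S` has point-orbit distribution `[n₁, n₂, n₃, n₄]`: it contains `n₁` rank-1 points,
`n₂` exterior rank-2 points, `n₃` interior rank-2 points and `n₄` rank-3 points. -/
def HasPointOrbitDistribution (F : Type*) [Field F] (S : Set (Matrix (Fin 3) (Fin 3) F))
    (n₁ n₂ n₃ n₄ : ℕ) : Prop :=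
  ptsWith F S (fun M => M.rank = 1) = n₁ ∧
  ptsWith F S Exterior = n₂ ∧
  ptsWith F S Interior = n₃ ∧
  ptsWith F S (fun M => M.rank = 3) = n₄

/-- A projective count: points with property `P` in a cone `S` are counted by any family of
representatives that is irredundant and exhaustive up to scalars. -/
theorem ptsWith_eq_card {F ι : Type*} [Field F] {S : Set (Matrix (Fin 3) (Fin 3) F)}
    {P : Matrix (Fin 3) (Fin 3) F → Prop} (f : ι → Matrix (Fin 3) (Fin 3) F)
    (hS : ∀ M ∈ S, ∀ r : F, r • M ∈ S)
    (hfS : ∀ i, f i ∈ S) (hf0 : ∀ i, f i ≠ 0) (hfP : ∀ i, P (f i))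
    (hinj : ∀ i j, ∀ r : F, r • f j = f i → i = j)
    (hsurj : ∀ M ∈ S, M ≠ 0 → P M → ∃ i, ∃ r : F, r • M = f i) :
    ptsWith F S P = Nat.card ι := by
  have hspan : Function.Injective fun i => Submodule.span F {f i} := by
    intro i j hij
    have hi : f i ∈ Submodule.span F {f j} := by
      rw [← show Submodule.span F {f i} = Submodule.span F {f j} from hij]
      exact Submodule.mem_span_singleton_self _
    obtain ⟨r, hr⟩ := Submodule.mem_span_singleton.mp hi
    exact hinj i j r hr
  rw [ptsWith, ← Set.ncard_range_of_injective hspan]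
  congr 1
  ext p
  constructor
  · rintro ⟨hpS, hp, M, hMp, hM0, hPM⟩
    obtain ⟨i, r, hr⟩ := hsurj M (hpS hMp) hM0 hPM
    refine ⟨i, ?_⟩
    have hip : f i ∈ p := hr ▸ p.smul_mem r hMp
    have : FiniteDimensional F p := Module.finite_of_finrank_eq_succ hp
    refine Submodule.eq_of_le_of_finrank_eq ?_ ?_
    · rwa [Submodule.span_singleton_le_iff_mem]
    · rw [hp, finrank_span_singleton (hf0 i)]
  · rintro ⟨i, rfl⟩
    refine ⟨?_, finrank_span_singleton (hf0 i), f i, Submodule.mem_span_singleton_self _,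
      hf0 i, hfP i⟩
    intro M hM
    obtain ⟨r, rfl⟩ := Submodule.mem_span_singleton.mp hM
    exact hS _ (hfS i) r

theorem rank_eq_of_congruent {F n : Type*} [Field F] [Fintype n] [DecidableEq n]
    {A M D : Matrix n n F} (hA : IsUnit A) (h : A * M * Aᵀ = D) : M.rank = D.rank := by
  have hA' : IsUnit A.det := (isUnit_iff_isUnit_det A).mp hA
  rw [← h, rank_mul_eq_left_of_isUnit_det _ _ (by rwa [det_transpose]),
    rank_mul_eq_right_of_isUnit_det _ _ hA']

theorem rank_diagonal_one_zero {F : Type*} [Field F] {x : F} (hx : x ≠ 0) :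
    (diagonal ![1, x, 0] : Matrix (Fin 3) (Fin 3) F).rank = 2 := by
  classical
  rw [rank_diagonal, Fintype.card_subtype]
  simp [Finset.filter, Fin.univ_succ, hx]

theorem Exterior.rank_eq {F : Type*} [Field F] {M : Matrix (Fin 3) (Fin 3) F}
    (h : Exterior M) : M.rank = 2 := by
  obtain ⟨A, hA, h⟩ := h
  rw [rank_eq_of_congruent hA h, rank_diagonal_one_zero (neg_ne_zero.mpr one_ne_zero)]

theorem Interior.rank_eq {F : Type*} [Field F] {M : Matrix (Fin 3) (Fin 3) F}
    (h : Interior M) : M.rank = 2 := by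
  obtain ⟨A, ε, hA, hε, h⟩ := h
  rw [rank_eq_of_congruent hA h, rank_diagonal_one_zero]
  intro h0
  exact hε (neg_eq_zero.mp h0 ▸ IsSquare.zero)

theorem Exterior.not_interior {F : Type*} [Field F] {M : Matrix (Fin 3) (Fin 3) F}
    (h : Exterior M) : ¬ Interior M := by
  obtain ⟨A, hA, hAM⟩ := h
  rintro ⟨B, ε, hB, hε, hBM⟩
  have hA' : IsUnit A.det := (isUnit_iff_isUnit_det A).mp hA
  have hAt : IsUnit Aᵀ.det := by rwa [det_transpose]
  set C := B * A⁻¹ with hC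
  have hCD : C * diagonal ![1, -1, 0] * Cᵀ = diagonal ![1, -ε, 0] := by
    rw [← hBM, ← hAM, hC, transpose_mul, transpose_nonsing_inv]
    simp only [Matrix.mul_assoc]
    rw [mul_nonsing_inv_cancel_left _ _ hAt, nonsing_inv_mul_cancel_left _ _ hA']
  have h00 := congrFun₂ hCD 0 0
  have h01 := congrFun₂ hCD 0 1
  have h11 := congrFun₂ hCD 1 1
  simp [Matrix.mul_apply, Fin.sum_univ_three, diagonal_apply] at h00 h01 h11
  refine hε ⟨C 0 0 * C 1 1 - C 0 1 * C 1 0, ?_⟩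
  grind

/-- The general matrix of the plane under study. -/
def planeMatrix {F : Type*} [Field F] (a b c : F) : Matrix (Fin 3) (Fin 3) F :=
  !![a + c, c, c; c, b + c, c; c, c, -b]

section planeMatrix

variable {F : Type*} [Field F]

theorem planeMatrix_inj {a b c a' b' c' : F} :
    planeMatrix a b c = planeMatrix a' b' c' ↔ a = a' ∧ b = b' ∧ c = c' := by
  refine ⟨fun h => ?_, by rintro ⟨rfl, rfl, rfl⟩; rfl⟩
  have h0 := congrFun₂ h 0 0
  have h1 := congrFun₂ h 1 1
  have h2 := congrFun₂ h 0 1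
  simp [planeMatrix] at h0 h1 h2
  grind

theorem planeMatrix_zero : planeMatrix (0 : F) 0 0 = 0 := by
  ext i j
  fin_cases i <;> fin_cases j <;> simp [planeMatrix]

theorem smul_planeMatrix (r a b c : F) :
    r • planeMatrix a b c = planeMatrix (r * a) (r * b) (r * c) := by
  ext i j
  fin_cases i <;> fin_cases j <;> simp [planeMatrix, mul_add]

theorem det_planeMatrix (h3 : (3 : F) = 0) (a b c : F) :
    (planeMatrix a b c).det = c ^ 3 - (a + c) * (b - c) ^ 2 := by
  simp [planeMatrix, det_fin_three]
  linear_combination (-(a + c) * b * c) * h3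

theorem rank_planeMatrix_left {a : F} (ha : a ≠ 0) : (planeMatrix a 0 0).rank = 1 := by
  classical
  have h : planeMatrix a 0 0 = diagonal ![a, 0, 0] := by
    ext i j
    fin_cases i <;> fin_cases j <;> simp [planeMatrix]
  rw [h, rank_diagonal, Fintype.card_subtype]
  simp [Finset.filter, Fin.univ_succ, ha]

theorem rank_planeMatrix_of_det_ne_zero (h3 : (3 : F) = 0) {a b c : F}
    (h : c ^ 3 - (a + c) * (b - c) ^ 2 ≠ 0) : (planeMatrix a b c).rank = 3 := by
  rw [← det_planeMatrix h3] at h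
  simpa using rank_of_isUnit _ ((isUnit_iff_isUnit_det _).mpr h.isUnit)

theorem exterior_planeMatrix (h3 : (3 : F) = 0) {a b c : F} (hbc : b ≠ c)
    (h : c ^ 3 - (a + c) * (b - c) ^ 2 = 0) : Exterior (planeMatrix a b c) := by
  have hd : b - c ≠ 0 := sub_ne_zero.mpr hbc
  obtain ⟨e, he⟩ : ∃ e, e * (b - c) = 1 := ⟨_, inv_mul_cancel₀ hd⟩
  refine ⟨!![0, (-b - 1) * e, (b + c - 1) * e; 0, (-b + 1) * e, (b + c + 1) * e;
    -(b - c) ^ 2, c * (b + c), -(b * c)], ?_, ?_⟩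
  · rw [isUnit_iff_isUnit_det, isUnit_iff_ne_zero, det_fin_three]
    simp
    grind
  · ext i j
    fin_cases i <;> fin_cases j <;>
      simp [planeMatrix, Matrix.mul_apply, Fin.sum_univ_three] <;> grind

/-- The nonzero matrices of the plane have rank 1, or are exterior, or have rank 3. -/
theorem planeMatrix_cases (h3 : (3 : F) = 0) {a b c : F} (h0 : planeMatrix a b c ≠ 0) :
    (a ≠ 0 ∧ b = 0 ∧ c = 0 ∧ (planeMatrix a b c).rank = 1) ∨
    (b ≠ c ∧ c ^ 3 - (a + c) * (b - c) ^ 2 = 0 ∧ Exterior (planeMatrix a b c) ∧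
      (planeMatrix a b c).rank = 2) ∨
    (c ^ 3 - (a + c) * (b - c) ^ 2 ≠ 0 ∧ (planeMatrix a b c).rank = 3) := by
  by_cases hdet : c ^ 3 - (a + c) * (b - c) ^ 2 = 0
  · by_cases hbc : b = c
    · obtain rfl : c = 0 := by simpa [hbc] using hdet
      subst hbc
      have ha : a ≠ 0 := by
        rintro rfl
        exact h0 planeMatrix_zero
      exact Or.inl ⟨ha, rfl, rfl, rank_planeMatrix_left ha⟩
    · have hext := exterior_planeMatrix h3 hbc hdet
      exact Or.inr (Or.inl ⟨hbc, hdet, hext, hext.rank_eq⟩)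
  · exact Or.inr (Or.inr ⟨hdet, rank_planeMatrix_of_det_ne_zero h3 hdet⟩)

/-- The plane of all matrices `planeMatrix a b c`. -/
def plane (F : Type*) [Field F] : Set (Matrix (Fin 3) (Fin 3) F) :=
  {M | ∃ a b c : F, M = planeMatrix a b c}

theorem smul_mem_plane (M : Matrix (Fin 3) (Fin 3) F) (hM : M ∈ plane F) (r : F) :
    r • M ∈ plane F := by
  obtain ⟨a, b, c, rfl⟩ := hM
  exact ⟨_, _, _, smul_planeMatrix r a b c⟩

theorem planeMatrix_ne_zero {a b c : F} (h : ¬ (a = 0 ∧ b = 0 ∧ c = 0)) :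
    planeMatrix a b c ≠ 0 := by
  rwa [Ne, ← planeMatrix_zero, planeMatrix_inj]

theorem ptsWith_plane_rank_one (h3 : (3 : F) = 0) :
    ptsWith F (plane F) (fun M => M.rank = 1) = 1 := by
  rw [ptsWith_eq_card (fun _ : Unit => planeMatrix 1 0 0) smul_mem_plane
    (fun _ => ⟨_, _, _, rfl⟩) (fun _ => planeMatrix_ne_zero (by simp))
    (fun _ => rank_planeMatrix_left one_ne_zero) (fun _ _ _ _ => rfl), Nat.card_unique]
  rintro _ ⟨a, b, c, rfl⟩ h0 h1
  obtain ⟨ha, rfl, rfl, -⟩ | ⟨-, -, -, h⟩ | ⟨-, h⟩ := planeMatrix_cases h3 h0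
  · exact ⟨(), a⁻¹, by simp [smul_planeMatrix, ha]⟩
  all_goals omega

theorem ptsWith_plane_exterior (h3 : (3 : F) = 0) :
    ptsWith F (plane F) Exterior = Nat.card F := by
  refine ptsWith_eq_card (fun t : F => planeMatrix (t ^ 3 - t) (t + 1) t) smul_mem_plane
    (fun _ => ⟨_, _, _, rfl⟩) (fun t => planeMatrix_ne_zero (by grind))
    (fun t => exterior_planeMatrix h3 (by simp) (by ring)) ?_ ?_
  · intro s t r h
    rw [smul_planeMatrix, planeMatrix_inj] at h
    grind
  · rintro _ ⟨a, b, c, rfl⟩ h0 h1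
    have h2 := h1.rank_eq
    obtain ⟨-, -, -, h⟩ | ⟨hbc, hdet, -, -⟩ | ⟨-, h⟩ := planeMatrix_cases h3 h0
    · omega
    · have hd : b - c ≠ 0 := sub_ne_zero.mpr hbc
      refine ⟨c * (b - c)⁻¹, (b - c)⁻¹, ?_⟩
      rw [smul_planeMatrix, planeMatrix_inj]
      refine ⟨?_, ?_, ?_⟩
      · field_simp
        linear_combination -hdet
      · field_simp
        ring
      · ring
    · omega

theorem ptsWith_plane_interior (h3 : (3 : F) = 0) :
    ptsWith F (plane F) Interior = 0 := by
  rw [ptsWith_eq_card (fun e : Empty => e.elim) smul_mem_plane nofun nofun nofun nofun,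
    Nat.card_of_isEmpty]
  rintro _ ⟨a, b, c, rfl⟩ h0 h1
  have h2 := h1.rank_eq
  obtain ⟨-, -, -, h⟩ | ⟨-, -, hext, -⟩ | ⟨-, h⟩ := planeMatrix_cases h3 h0
  · omega
  · exact absurd h1 hext.not_interior
  · omega

theorem ptsWith_plane_rank_three (h3 : (3 : F) = 0) :
    ptsWith F (plane F) (fun M => M.rank = 3) = Nat.card F ^ 2 := by
  classical
  rw [sq, ← Nat.card_prod]
  refine ptsWith_eq_card (fun x : F × F => if x.1 = 0 then planeMatrix x.2 1 1 else
    planeMatrix (x.2 ^ 3 - x.2 + x.1) (x.2 + 1) x.2) smul_mem_plane ?_ ?_ ?_ ?_ ?_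
  · rintro ⟨s, t⟩
    dsimp only
    split_ifs <;> exact ⟨_, _, _, rfl⟩
  · rintro ⟨s, t⟩
    dsimp only
    split_ifs <;> exact planeMatrix_ne_zero (by grind)
  · rintro ⟨s, t⟩
    dsimp only
    split_ifs with hs
    · exact rank_planeMatrix_of_det_ne_zero h3 (by simp)
    · refine rank_planeMatrix_of_det_ne_zero h3 fun h => hs ?_
      linear_combination -h
  · rintro ⟨s, t⟩ ⟨s', t'⟩ r h
    dsimp only at h
    rw [Prod.mk.injEq]
    split_ifs at h <;> rw [smul_planeMatrix, planeMatrix_inj] at h <;> grind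
  · rintro _ ⟨a, b, c, rfl⟩ h0 h1
    obtain ⟨-, -, -, h⟩ | ⟨-, -, -, h⟩ | ⟨hdet, -⟩ := planeMatrix_cases h3 h0
    · omega
    · omega
    · by_cases hbc : b = c
      · have hc : c ≠ 0 := by
          rintro rfl
          simp [hbc] at hdet
        exact ⟨(0, c⁻¹ * a), c⁻¹, by simp [smul_planeMatrix, hbc, hc]⟩
      · have hd : b - c ≠ 0 := sub_ne_zero.mpr hbc
        refine ⟨(-(c ^ 3 - (a + c) * (b - c) ^ 2) * (b - c)⁻¹ ^ 3, c * (b - c)⁻¹),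
          (b - c)⁻¹, ?_⟩
        rw [if_neg (mul_ne_zero (neg_ne_zero.mpr hdet) (pow_ne_zero 3 (inv_ne_zero hd))),
          smul_planeMatrix, planeMatrix_inj]
        refine ⟨?_, ?_, ?_⟩
        · field_simp
          ring
        · field_simp
          ring
        · ring

end planeMatrix

/-- Over a finite field of order a power of 3, the plane `Σ₁₄'` representative has
point-orbit distribution `[1, q, 0, q²]`: it contains exactly one rank-1 point, exactly `q`
rank-2 points, all of which are exterior, and `q²` rank-3 points. -/
theorem distribution_Sigma14' (F : Type*) [Field F] [Fintype F]
    (hcard : ∃ n : ℕ, 0 < n ∧ Fintype.card F = 3 ^ n) :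
    HasPointOrbitDistribution F
      {M | ∃ a b c : F, M = !![a + c, c, c; c, b + c, c; c, c, -b]}
      1
      (Fintype.card F)
      0
      (Fintype.card F ^ 2) ∧
    ∀ M ∈ {M : Matrix (Fin 3) (Fin 3) F | ∃ a b c : F, M = !![a + c, c, c; c, b + c, c; c, c, -b]},
      M.rank = 2 → Exterior M := by
  obtain ⟨n, hn, hq⟩ := hcard
  have h3 : (3 : F) = 0 := by
    have h := Nat.cast_card_eq_zero F
    rw [hq, Nat.cast_pow] at h
    exact_mod_cast eq_zero_of_pow_eq_zero h
  rw [← Nat.card_eq_fintype_card]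
  refine ⟨⟨ptsWith_plane_rank_one h3, ptsWith_plane_exterior h3, ptsWith_plane_interior h3,
    ptsWith_plane_rank_three h3⟩, ?_⟩
  rintro _ ⟨a, b, c, rfl⟩ h2
  change (planeMatrix a b c).rank = 2 at h2
  have h0 : planeMatrix a b c ≠ 0 := by
    intro h
    simp [h] at h2
  obtain ⟨-, -, -, h⟩ | ⟨-, -, h, -⟩ | ⟨-, h⟩ := planeMatrix_cases h3 h0
  · omega
  · exact h
  · omega
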